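/- Any two elements of the positive braid monoid B_n^+ admit a greatest common left-divisor: for all a, b in B_n^+ there exists d in B_n^+ such that d left-divides a, d left-divides b, and every common left-divisor of a and b left-divides d. -/

import Mathlib

/-- In a monoid, `a` left-divides `b` if `b = a * c` for some `c`. -/
def LeftDvd {M : Type*} [Monoid M] (a b : M) : Prop := ∃ c, b = a * c

/-- `d` is a greatest common left-divisor of `a` and `b`: it is a common left-divisor
of `a` and `b` which is left-divided by every common left-divisor of `a` and `b`. -/
def IsGCLD {M : Type*} [Monoid M] (a b d : M) : Prop :=
  LeftDvd d a ∧ LeftDvd d b ∧ ∀ e, LeftDvd e a → LeftDvd e b → LeftDvd e d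

/-- The braid relations on the free monoid over `Fin (n - 1)`: the index `i : Fin (n - 1)`
stands for the Artin generator `σ_{i+1}` (indices are 0-based), and the relations are
`σ_i σ_j σ_i = σ_j σ_i σ_j` for `|i - j| = 1` and `σ_i σ_j = σ_j σ_i` for `|i - j| ≥ 2`. -/
def braidRels (n : ℕ) : FreeMonoid (Fin (n - 1)) → FreeMonoid (Fin (n - 1)) → Prop :=
  fun x y =>
    (∃ i j : Fin (n - 1), (i : ℕ) + 1 = (j : ℕ) ∧
        x = .of i * .of j * .of i ∧ y = .of j * .of i * .of j) ∨
    (∃ i j : Fin (n - 1), (i : ℕ) + 2 ≤ (j : ℕ) ∧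
        x = .of i * .of j ∧ y = .of j * .of i)

/-- The positive braid monoid `B_n⁺`, presented by the generators `σ_1, …, σ_{n-1}`
and the braid relations. -/
def BraidMonoid (n : ℕ) := PresentedMonoid (braidRels n)

instance (n : ℕ) : Monoid (BraidMonoid n) :=
  inferInstanceAs (Monoid (PresentedMonoid (braidRels n)))

/-- The generator `σ_{i+1}` of `B_n⁺` (0-based index `i : Fin (n - 1)`). -/
def σ {n : ℕ} (i : Fin (n - 1)) : BraidMonoid n := PresentedMonoid.of (braidRels n) i

namespace BraidMonoid

variable {n : ℕ}

/-- Two indices are adjacent if they differ by one. -/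
def Adj (i j : Fin (n - 1)) : Prop := (i : ℕ) + 1 = j ∨ (j : ℕ) + 1 = i

theorem Adj.symm {i j : Fin (n - 1)} (h : Adj i j) : Adj j i := Or.symm h

theorem Adj.ne {i j : Fin (n - 1)} (h : Adj i j) : i ≠ j := by
  rintro rfl
  rcases h with h | h <;> omega

theorem Adj.triangle_free {i j k : Fin (n - 1)} (h : Adj i j) (h' : Adj j k) : ¬Adj i k := by
  unfold Adj at *
  omega

theorem braid {i j : Fin (n - 1)} (h : Adj i j) :
    (σ i * (σ j * σ i) : BraidMonoid n) = σ j * (σ i * σ j) := by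
  have key : ∀ i j : Fin (n - 1), (i : ℕ) + 1 = j →
      (σ i * (σ j * σ i) : BraidMonoid n) = σ j * (σ i * σ j) := fun i j h => by
    rw [← mul_assoc, ← mul_assoc]
    exact PresentedMonoid.mk_eq_mk_of_rel (Or.inl ⟨i, j, h, rfl, rfl⟩)
  rcases h with h | h
  · exact key i j h
  · exact (key j i h).symm

theorem comm {i j : Fin (n - 1)} (hne : i ≠ j) (h : ¬Adj i j) :
    (σ i * σ j : BraidMonoid n) = σ j * σ i := by
  have key : ∀ i j : Fin (n - 1), (i : ℕ) + 2 ≤ j →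
      (σ i * σ j : BraidMonoid n) = σ j * σ i := fun i j h =>
    PresentedMonoid.mk_eq_mk_of_rel (Or.inr ⟨i, j, h, rfl, rfl⟩)
  have hne' : (i : ℕ) ≠ j := fun e => hne (Fin.ext e)
  unfold Adj at h
  rcases lt_or_gt_of_ne hne' with hlt | hlt
  · exact key i j (by omega)
  · exact (key j i (by omega)).symm

theorem braid_assoc {i j : Fin (n - 1)} (h : Adj i j) (x : BraidMonoid n) :
    σ i * (σ j * (σ i * x)) = σ j * (σ i * (σ j * x)) := by
  simpa only [mul_assoc] using congrArg (· * x) (braid h)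

theorem comm_assoc {i j : Fin (n - 1)} (hne : i ≠ j) (h : ¬Adj i j) (x : BraidMonoid n) :
    σ i * (σ j * x) = σ j * (σ i * x) := by
  simpa only [mul_assoc] using congrArg (· * x) (comm hne h)

/-- A family of elements of a monoid satisfying the braid relations induces a homomorphism
from the braid monoid. -/
def lift {N : Type*} [Monoid N] (f : Fin (n - 1) → N)
    (hb : ∀ i j, Adj i j → f i * f j * f i = f j * f i * f j)
    (hc : ∀ i j, i ≠ j → ¬Adj i j → f i * f j = f j * f i) : BraidMonoid n →* N :=
  PresentedMonoid.lift f (rels := braidRels n) (by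
    rintro _ _ (⟨i, j, h, rfl, rfl⟩ | ⟨i, j, h, rfl, rfl⟩)
    · simpa using hb i j (Or.inl h)
    · have hne : i ≠ j := by rintro rfl; omega
      simpa using hc i j hne (by unfold Adj; omega))

@[elab_as_elim]
theorem induction_left {p : BraidMonoid n → Prop} (one : p 1)
    (mul : ∀ i x, p x → p (σ i * x)) (x : BraidMonoid n) : p x := by
  induction x using PresentedMonoid.inductionOn with
  | _ w =>
    induction w using FreeMonoid.inductionOn' with
    | one => exact one
    | of_mul i w ih => exact mul i _ ih

theorem eq_one_or_exists_eq_σ_mul (x : BraidMonoid n) : x = 1 ∨ ∃ i y, x = σ i * y := by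
  induction x using induction_left with
  | one => exact Or.inl rfl
  | mul i x _ => exact Or.inr ⟨i, x, rfl⟩

/-- The word length, as a homomorphism. -/
def lengthHom : BraidMonoid n →* Multiplicative ℕ :=
  lift (fun _ => .ofAdd 1) (fun _ _ _ => rfl) fun _ _ _ _ => rfl

/-- The word length of a positive braid. -/
def length (x : BraidMonoid n) : ℕ := (lengthHom x).toAdd

@[simp]
theorem length_one : length (1 : BraidMonoid n) = 0 := by simp [length]

@[simp]
theorem length_mul (x y : BraidMonoid n) : length (x * y) = length x + length y := by
  simp [length]

@[simp]
theorem length_σ (i : Fin (n - 1)) : length (σ i : BraidMonoid n) = 1 := rfl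

theorem eq_one_of_length_eq_zero {x : BraidMonoid n} (h : length x = 0) : x = 1 := by
  rcases eq_one_or_exists_eq_σ_mul x with rfl | ⟨i, y, rfl⟩
  · rfl
  · simp at h

open Classical in
/-- The complement of `σ i` in the least common right-multiple of `σ i` and `σ j`. -/
noncomputable def compl (i j : Fin (n - 1)) : BraidMonoid n :=
  if i = j then 1 else if Adj i j then σ j * σ i else σ j

@[simp]
theorem compl_self (i : Fin (n - 1)) : compl i i = 1 := by simp [compl]

theorem compl_of_adj {i j : Fin (n - 1)} (h : Adj i j) : compl i j = σ j * σ i := by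
  simp [compl, h, h.ne]

theorem compl_of_not_adj {i j : Fin (n - 1)} (hne : i ≠ j) (h : ¬Adj i j) :
    compl i j = σ j := by
  simp [compl, h, hne]

theorem σ_mul_compl (i j : Fin (n - 1)) : σ i * compl i j = σ j * compl j i := by
  by_cases hne : i = j
  · rw [hne]
  by_cases h : Adj i j
  · rw [compl_of_adj h, compl_of_adj h.symm, braid h]
  · rw [compl_of_not_adj hne h, compl_of_not_adj (Ne.symm hne) (fun h' => h h'.symm), comm hne h]

/-- The pairs `(i, x)` and `(j, y)` are linked if `σ i * x = σ j * y` holds because both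
sides are the same right-multiple of the least common right-multiple of `σ i` and `σ j`. -/
def Linked (p q : Fin (n - 1) × BraidMonoid n) : Prop :=
  ∃ z, p.2 = compl p.1 q.1 * z ∧ q.2 = compl q.1 p.1 * z

theorem Linked.refl (p : Fin (n - 1) × BraidMonoid n) : Linked p p := ⟨p.2, by simp⟩

theorem Linked.symm {p q : Fin (n - 1) × BraidMonoid n} (h : Linked p q) : Linked q p :=
  let ⟨z, h₁, h₂⟩ := h
  ⟨z, h₂, h₁⟩

theorem Linked.mul_right {p q : Fin (n - 1) × BraidMonoid n} (h : Linked p q)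
    (x : BraidMonoid n) : Linked (p.1, p.2 * x) (q.1, q.2 * x) :=
  let ⟨z, h₁, h₂⟩ := h
  ⟨z * x, by simp [h₁, mul_assoc], by simp [h₂, mul_assoc]⟩

theorem Linked.σ_mul_eq {p q : Fin (n - 1) × BraidMonoid n} (h : Linked p q) :
    σ p.1 * p.2 = σ q.1 * q.2 := by
  obtain ⟨z, h₁, h₂⟩ := h
  rw [h₁, h₂, ← mul_assoc, ← mul_assoc, σ_mul_compl]

/-- Right multiplication by `x` on classes of pairs `(i, y)`, which stand for the nonempty
words `σ i * y`; `none` stands for the empty word. -/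
def mulRight (x : BraidMonoid n) :
    Quot (Linked (n := n)) → Quot (Linked (n := n)) :=
  Quot.map (fun p => (p.1, p.2 * x)) fun _ _ h => h.mul_right x

/-- The right action of a generator on classes of pairs. -/
def genAct (i : Fin (n - 1)) : (Function.End (Option (Quot (Linked (n := n)))))ᵐᵒᵖ :=
  .op fun c => some (c.elim (Quot.mk _ (i, 1)) (mulRight (σ i)))

/-- The right action of the braid monoid on classes of pairs. -/
def actHom : BraidMonoid n →* (Function.End (Option (Quot (Linked (n := n)))))ᵐᵒᵖ :=
  lift genAct
    (fun i j h => by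
      apply MulOpposite.unop_injective
      funext c
      rcases c with _ | ⟨k, x⟩
      · refine congrArg some (Quot.sound ⟨1, ?_, ?_⟩)
        · simp [compl_of_adj h]
        · simp [compl_of_adj h.symm]
      · refine congrArg (fun y => some (Quot.mk _ (k, y))) ?_
        change x * σ i * σ j * σ i = x * σ j * σ i * σ j
        simp only [mul_assoc, braid h])
    (fun i j hne h => by
      apply MulOpposite.unop_injective
      funext c
      rcases c with _ | ⟨k, x⟩
      · refine congrArg some (Quot.sound ⟨1, ?_, ?_⟩)
        · simp [compl_of_not_adj hne h]
        · simp [compl_of_not_adj hne.symm fun h' => h h'.symm]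
      · refine congrArg (fun y => some (Quot.mk _ (k, y))) ?_
        change x * σ i * σ j = x * σ j * σ i
        simp only [mul_assoc, comm hne h])

theorem actHom_some (x : BraidMonoid n) (i : Fin (n - 1)) (y : BraidMonoid n) :
    (actHom x).unop (some (Quot.mk _ (i, y))) = some (Quot.mk _ (i, y * x)) := by
  induction x using induction_left generalizing y with
  | one => rw [mul_one, map_one]; rfl
  | mul j x ih =>
    rw [map_mul, ← mul_assoc]
    exact ih (y * σ j)

theorem actHom_none (i : Fin (n - 1)) (x : BraidMonoid n) :
    (actHom (σ i * x)).unop none = some (Quot.mk _ (i, x)) := by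
  have h := actHom_some x i 1
  rw [one_mul] at h
  rw [map_mul]
  exact h

theorem eqvGen_linked {i j : Fin (n - 1)} {x y : BraidMonoid n} (h : σ i * x = σ j * y) :
    Relation.EqvGen Linked (i, x) (j, y) := by
  apply Quot.eqvGen_exact
  apply Option.some_injective
  rw [← actHom_none, ← actHom_none, h]

/-- The cube condition: `Linked` is transitive at a given length, provided it describes
equality at all smaller lengths. -/
theorem Linked.trans_of_length {s k t : Fin (n - 1)} {x w y : BraidMonoid n}
    (ih : ∀ (i j : Fin (n - 1)) (u v : BraidMonoid n), length u < length w →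
      σ i * u = σ j * v → Linked (i, u) (j, v))
    (h₁ : Linked (s, x) (k, w)) (h₂ : Linked (k, w) (t, y)) : Linked (s, x) (t, y) := by
  have cancel : ∀ (i : Fin (n - 1)) (u v : BraidMonoid n), length u < length w →
      σ i * u = σ i * v → u = v := fun i u v hl h => by
    obtain ⟨z, hu, hv⟩ := ih i i u v hl h
    simp only [compl_self, one_mul] at hu hv
    exact hu.trans hv.symm
  have ihA : ∀ (i j : Fin (n - 1)) (u v : BraidMonoid n), Adj i j → length u < length w →
      σ i * u = σ j * v → ∃ z, u = σ j * (σ i * z) ∧ v = σ i * (σ j * z) :=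
    fun i j u v hA hl h => by
      obtain ⟨z, hu, hv⟩ := ih i j u v hl h
      exact ⟨z, by simpa [compl_of_adj hA, mul_assoc] using hu,
        by simpa [compl_of_adj hA.symm, mul_assoc] using hv⟩
  have ihC : ∀ (i j : Fin (n - 1)) (u v : BraidMonoid n), i ≠ j → ¬Adj i j →
      length u < length w → σ i * u = σ j * v → ∃ z, u = σ j * z ∧ v = σ i * z :=
    fun i j u v hne hA hl h => by
      obtain ⟨z, hu, hv⟩ := ih i j u v hl h
      exact ⟨z, by simpa [compl_of_not_adj hne hA] using hu,
        by simpa [compl_of_not_adj hne.symm fun h' => hA h'.symm] using hv⟩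
  by_cases hsk : s = k
  · subst hsk
    obtain ⟨u, hx, hw⟩ := h₁
    simp only [compl_self, one_mul] at hx hw
    rwa [hx, ← hw]
  by_cases hkt : k = t
  · subst hkt
    obtain ⟨u, hw, hy⟩ := h₂
    simp only [compl_self, one_mul] at hw hy
    rwa [hy, ← hw]
  have not_adj_symm : ∀ {i j : Fin (n - 1)}, ¬Adj i j → ¬Adj j i := fun h h' => h h'.symm
  have mixed : ∀ (s t : Fin (n - 1)) (x y u v : BraidMonoid n), s ≠ k → s ≠ t → ¬Adj s k →
      Adj k t → x = σ k * u → w = σ s * u → w = σ t * (σ k * v) → y = σ k * (σ t * v) →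
      Linked (s, x) (t, y) := by
    intro s t x y u v hsk hst hsk' hkt hx hu hv hy
    have hl := congrArg length hu
    have hl' := congrArg length hv
    simp only [length_mul, length_σ] at hl hl'
    by_cases hst' : Adj s t
    · obtain ⟨z₁, hu₁, hv₁⟩ := ihA s t _ _ hst' (by omega) (hu.symm.trans hv)
      obtain ⟨z₂, hv₂, hz₂⟩ := ihC k s _ _ (Ne.symm hsk) (not_adj_symm hsk') (by omega) hv₁
      have hlz := congrArg length hu₁
      simp only [length_mul, length_σ] at hlz
      obtain ⟨z₃, hz₁, hz₂'⟩ := ihA t k _ _ hkt.symm (by omega) hz₂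
      refine ⟨σ k * (σ t * (σ s * z₃)), ?_, ?_⟩
      · rw [compl_of_adj hst']
        simp only [hx, hu₁, hz₁, mul_assoc]
        rw [comm_assoc hsk hsk', braid_assoc hkt, braid_assoc hst'.symm,
          comm_assoc (Ne.symm hsk) (not_adj_symm hsk')]
      · rw [compl_of_adj hst'.symm]
        simp only [hy, hv₂, hz₂', mul_assoc]
        rw [braid_assoc hst'.symm, comm_assoc (Ne.symm hsk) (not_adj_symm hsk'),
          comm_assoc hsk hsk' z₃, braid_assoc hkt]
    · obtain ⟨z₁, hu₁, hv₁⟩ := ihC s t _ _ hst hst' (by omega) (hu.symm.trans hv)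
      obtain ⟨z₂, hv₂, hz₂⟩ := ihC k s _ _ (Ne.symm hsk) (not_adj_symm hsk') (by omega) hv₁
      refine ⟨σ k * (σ t * z₂), ?_, ?_⟩
      · rw [compl_of_not_adj hst hst']
        simp only [hx, hu₁, hz₂]
        rw [braid_assoc hkt]
      · rw [compl_of_not_adj hst.symm (not_adj_symm hst')]
        simp only [hy, hv₂]
        rw [comm_assoc hst.symm (not_adj_symm hst'), comm_assoc (Ne.symm hsk) (not_adj_symm hsk')]
  obtain ⟨u, hx, hu⟩ := h₁
  obtain ⟨v, hv, hy⟩ := h₂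
  dsimp only at hx hu hv hy
  by_cases hst : s = t
  · subst hst
    have huv : u = v := by
      have hl := congrArg length hu
      have e := hu.symm.trans hv
      by_cases h : Adj k s
      · rw [compl_of_adj h] at e hl
        simp only [length_mul, length_σ, mul_assoc] at hl e
        have e' := cancel _ _ _ (by simp; omega) e
        exact cancel _ _ _ (by omega) e'
      · rw [compl_of_not_adj hkt h] at e hl
        simp only [length_mul, length_σ] at hl
        exact cancel _ _ _ (by omega) e
    subst huv
    rw [hx, hy]
    exact Linked.refl _
  by_cases hA : Adj s k <;> by_cases hB : Adj k t
  · have hC := hA.triangle_free hB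
    simp only [compl_of_adj hA, compl_of_adj hA.symm, compl_of_adj hB, compl_of_adj hB.symm,
      mul_assoc] at hx hu hv hy
    have hl := congrArg length hu
    have hl' := congrArg length hv
    simp only [length_mul, length_σ] at hl hl'
    obtain ⟨z₁, hu₁, hv₁⟩ := ihC s t _ _ hst hC (by simp; omega) (hu.symm.trans hv)
    obtain ⟨u', hu₂, hz⟩ := ihA k t _ _ hB (by omega) hu₁
    obtain ⟨v', hv₂, hz'⟩ := ihA k s _ _ hA.symm (by omega) hv₁
    have hlu := congrArg length hu₂
    have hlz := congrArg length hz
    have hlz' := congrArg length hz'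
    simp only [length_mul, length_σ] at hlu hlz hlz'
    have e := cancel _ _ _ (by simp; omega) (hz.symm.trans hz')
    obtain ⟨z, hu₃, hv₃⟩ := ihC t s _ _ (Ne.symm hst) (not_adj_symm hC) (by omega) e
    refine ⟨σ k * (σ t * (σ s * (σ k * z))), ?_, ?_⟩
    · rw [compl_of_not_adj hst hC]
      simp only [hx, hu₂, hu₃]
      rw [comm_assoc hst hC, braid_assoc hA, braid_assoc hB]
    · rw [compl_of_not_adj (Ne.symm hst) (not_adj_symm hC)]
      simp only [hy, hv₂, hv₃]
      rw [comm_assoc (Ne.symm hst) (not_adj_symm hC), braid_assoc hB.symm, braid_assoc hA.symm,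
        comm_assoc hst hC]
  · simp only [compl_of_adj hA, compl_of_adj hA.symm, compl_of_not_adj hkt hB,
      compl_of_not_adj (Ne.symm hkt) (not_adj_symm hB), mul_assoc] at hx hu hv hy
    exact (mixed t s y x v u (Ne.symm hkt) (Ne.symm hst) (not_adj_symm hB) hA.symm
      hy hv hu hx).symm
  · simp only [compl_of_adj hB, compl_of_adj hB.symm, compl_of_not_adj hsk hA,
      compl_of_not_adj (Ne.symm hsk) (not_adj_symm hA), mul_assoc] at hx hu hv hy
    exact mixed s t x y u v hsk hst hA hB hx hu hv hy
  · simp only [compl_of_not_adj hkt hB, compl_of_not_adj (Ne.symm hkt) (not_adj_symm hB),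
      compl_of_not_adj hsk hA, compl_of_not_adj (Ne.symm hsk) (not_adj_symm hA)] at hx hu hv hy
    have hl := congrArg length hu
    simp only [length_mul, length_σ] at hl
    obtain ⟨z, hu₁, hv₁⟩ := ih s t _ _ (by omega) (hu.symm.trans hv)
    dsimp only at hu₁ hv₁
    have hk : σ k * compl s t = compl s t * σ k ∧ σ k * compl t s = compl t s * σ k := by
      have hks := comm (Ne.symm hsk) (not_adj_symm hA)
      have hkt' := comm hkt hB
      by_cases hC : Adj s t
      · rw [compl_of_adj hC, compl_of_adj hC.symm]
        exact ⟨Commute.mul_right hkt' hks, Commute.mul_right hks hkt'⟩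
      · rw [compl_of_not_adj hst hC, compl_of_not_adj (Ne.symm hst) (not_adj_symm hC)]
        exact ⟨hkt', hks⟩
    exact ⟨σ k * z, by simp only [hx, hu₁, ← mul_assoc, hk.1],
      by simp only [hy, hv₁, ← mul_assoc, hk.2]⟩

/-- If `σ i * x = σ j * y`, this element is a right-multiple of the least common
right-multiple of `σ i` and `σ j`, and `x` and `y` are the corresponding quotients. -/
theorem linked_of_σ_mul_eq {i j : Fin (n - 1)} {x y : BraidMonoid n}
    (h : σ i * x = σ j * y) : Linked (i, x) (j, y) := by
  induction hN : length x using Nat.strong_induction_on generalizing i j x y with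
  | _ N ih =>
    have trans : ∀ p q r : Fin (n - 1) × BraidMonoid n, length q.2 = N →
        Linked p q → Linked q r → Linked p r := fun p q r hq h₁ h₂ =>
      Linked.trans_of_length (fun i j u v hu e => ih _ (hq ▸ hu) e rfl) h₁ h₂
    have length_eq : ∀ p q : Fin (n - 1) × BraidMonoid n, Relation.EqvGen Linked p q →
        length p.2 = length q.2 := fun p q h => by
      induction h with
      | rel p q h => simpa using congrArg length h.σ_mul_eq
      | refl p => rfl
      | symm p q _ ih => exact ih.symm
      | trans p q r _ _ ih₁ ih₂ => exact ih₁.trans ih₂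
    have key : ∀ p q : Fin (n - 1) × BraidMonoid n, Relation.EqvGen Linked p q →
        length p.2 = N → Linked p q := fun p q h => by
      induction h with
      | rel p q h => exact fun _ => h
      | refl p => exact fun _ => Linked.refl p
      | symm p q h ih => exact fun hq => (ih ((length_eq _ _ h).trans hq)).symm
      | trans p q r h h' ih₁ ih₂ =>
        intro hp
        have hq := (length_eq _ _ h).symm.trans hp
        exact trans p q r hq (ih₁ hp) (ih₂ hq)
    exact key _ _ (eqvGen_linked h) hN

theorem mul_left_cancel {x y z : BraidMonoid n} (h : x * y = x * z) : y = z := by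
  induction x using induction_left with
  | one => simpa using h
  | mul i x ih =>
    rw [mul_assoc, mul_assoc] at h
    obtain ⟨w, h₁, h₂⟩ := linked_of_σ_mul_eq h
    simp only [compl_self, one_mul] at h₁ h₂
    exact ih (h₁.trans h₂.symm)

/-- Two positive braids with a common right-multiple have a least one. -/
theorem exists_lcm {x y z : BraidMonoid n} (hx : LeftDvd x z) (hy : LeftDvd y z) :
    ∃ m, LeftDvd x m ∧ LeftDvd y m ∧ ∀ w, LeftDvd x w → LeftDvd y w → LeftDvd m w := by
  induction hN : length z using Nat.strong_induction_on generalizing x y z with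
  | _ N ih =>
    rcases eq_one_or_exists_eq_σ_mul x with rfl | ⟨i, x, rfl⟩
    · exact ⟨y, ⟨y, by simp⟩, ⟨1, by simp⟩, fun w _ h => h⟩
    rcases eq_one_or_exists_eq_σ_mul y with rfl | ⟨j, y, rfl⟩
    · exact ⟨_, ⟨1, by simp⟩, ⟨_, (one_mul _).symm⟩, fun w h _ => h⟩
    obtain ⟨p, rfl⟩ := hx
    obtain ⟨q, hq⟩ := hy
    rw [mul_assoc, mul_assoc] at hq
    rw [mul_assoc] at hN
    obtain ⟨r, hp, hq'⟩ := linked_of_σ_mul_eq hq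
    dsimp only at hp hq'
    have hl := congrArg length hq
    have hl' := congrArg length hp
    simp only [length_mul, length_σ] at hN hl hl'
    obtain ⟨_, hxb, ⟨b, rfl⟩, hb⟩ := ih _ (by simp; omega) ⟨p, rfl⟩ ⟨r, hp⟩ rfl
    obtain ⟨_, hyc, ⟨c, rfl⟩, hc⟩ := ih _ (by simp; omega) ⟨q, rfl⟩ ⟨r, hq'⟩ rfl
    have dvd_cancel : ∀ {u v w : BraidMonoid n}, LeftDvd (u * v) (u * w) → LeftDvd v w :=
      fun ⟨d, hd⟩ => ⟨d, mul_left_cancel (by rw [hd, mul_assoc])⟩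
    obtain ⟨m, ⟨d, hd⟩, ⟨e, he⟩, hm⟩ := ih (length r) (by omega)
      (dvd_cancel (hp ▸ hb _ ⟨p, rfl⟩ ⟨r, hp⟩)) (dvd_cancel (hq' ▸ hc _ ⟨q, rfl⟩ ⟨r, hq'⟩)) rfl
    refine ⟨σ i * compl i j * m, ?_, ?_, ?_⟩
    · obtain ⟨f, hf⟩ := hxb
      exact ⟨f * d, by rw [hd, ← mul_assoc, mul_assoc _ _ b, hf]; simp only [mul_assoc]⟩
    · obtain ⟨f, hf⟩ := hyc
      exact ⟨f * e, by
        rw [σ_mul_compl, he, ← mul_assoc, mul_assoc _ _ c, hf]; simp only [mul_assoc]⟩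
    · rintro _ ⟨f, rfl⟩ ⟨g, hg⟩
      rw [mul_assoc, mul_assoc] at hg
      obtain ⟨t, hf', hg'⟩ := linked_of_σ_mul_eq hg
      dsimp only at hf' hg'
      obtain ⟨o, ho⟩ := hm t (dvd_cancel (hf' ▸ hb _ ⟨f, rfl⟩ ⟨t, hf'⟩))
        (dvd_cancel (hg' ▸ hc _ ⟨g, rfl⟩ ⟨t, hg'⟩))
      exact ⟨o, by rw [mul_assoc, hf', ho]; simp only [mul_assoc]⟩

theorem length_le_of_leftDvd {x y : BraidMonoid n} (h : LeftDvd x y) : length x ≤ length y := by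
  obtain ⟨c, rfl⟩ := h
  simp

theorem eq_of_leftDvd_of_length_le {x y : BraidMonoid n} (h : LeftDvd x y)
    (hl : length y ≤ length x) : x = y := by
  obtain ⟨c, rfl⟩ := h
  rw [length_mul] at hl
  rw [eq_one_of_length_eq_zero (x := c) (by omega), mul_one]

end BraidMonoid

open BraidMonoid in
/-- Any two elements of the positive braid monoid `B_n⁺` admit a greatest common
left-divisor. -/
theorem braidMonoid_exists_gcd (n : ℕ) (hn : 1 ≤ n) (a b : BraidMonoid n) :
    ∃ d : BraidMonoid n, IsGCLD a b d := by
  let S : Set ℕ := {l | ∃ d : BraidMonoid n, LeftDvd d a ∧ LeftDvd d b ∧ length d = l}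
  have hfin : S.Finite := (Set.finite_Iic (length a)).subset fun l ⟨d, hd, _, hl⟩ =>
    hl ▸ length_le_of_leftDvd hd
  have hne : S.Nonempty := ⟨0, 1, ⟨a, by simp⟩, ⟨b, by simp⟩, by simp⟩
  obtain ⟨_, ⟨d, hda, hdb, rfl⟩, hmax⟩ := Set.exists_max_image S id hfin hne
  refine ⟨d, hda, hdb, fun e hea heb => ?_⟩
  obtain ⟨m, hdm, hem, hm⟩ := exists_lcm hda hea
  rwa [eq_of_leftDvd_of_length_le hdm (hmax _ ⟨m, hm a hda hea, hm b hdb heb, rfl⟩)]
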